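/- Under the geometrical assumption, the Hamiltonian flow (x(t,y), ξ(t,y)) is globally defined, and for every T > 0 and every multi-index α with |α| ≥ 1 there exists a constant C(α,T) such that ‖∂_y^α x(t,·)‖_{L^∞(ℝ^n)} + ‖∂_y^α ξ(t,·)‖_{L^∞(ℝ^n)} ≤ C(α,T) for all t ∈ [0,T]. -/

import Mathlib

open MeasureTheory Real Filter Set

noncomputable section

/-- Euclidean space ℝⁿ. -/
abbrev Esp (n : ℕ) := EuclideanSpace ℝ (Fin n)

/-- `i`-th standard basis vector. -/
def evec (n : ℕ) (i : Fin n) : Esp n := EuclideanSpace.single i 1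

/-- Partial derivative in the `i`-th coordinate direction. -/
def pd {n : ℕ} {F : Type*} [NormedAddCommGroup F] [NormedSpace ℝ F]
    (f : Esp n → F) (i : Fin n) (x : Esp n) : F :=
  fderiv ℝ f x (evec n i)

/-- Laplacian in the space variable. -/
def lap {n : ℕ} {F : Type*} [NormedAddCommGroup F] [NormedSpace ℝ F]
    (f : Esp n → F) (x : Esp n) : F :=
  ∑ i, pd (fun y => pd f i y) i x

/-- `∇φ·∇a` for a real-valued `φ` and a complex-valued `a` (componentwise). -/
def gdotC {n : ℕ} (φ : Esp n → ℝ) (a : Esp n → ℂ) (x : Esp n) : ℂ :=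
  ∑ i, ((pd φ i x : ℝ) : ℂ) * pd a i x

/-- `∇φ·∇ψ` for real-valued functions. -/
def gdotR {n : ℕ} (φ ψ : Esp n → ℝ) (x : Esp n) : ℝ :=
  ∑ i, pd φ i x * pd ψ i x

/-- Jacobian determinant of a map ℝⁿ → ℝⁿ. -/
def jacDet {n : ℕ} (g : Esp n → Esp n) (y : Esp n) : ℝ :=
  LinearMap.det ((fderiv ℝ g y) : Esp n →ₗ[ℝ] Esp n)

/-- Square of the Sobolev `H^s` norm (via iterated derivatives). -/
def HsNormSq {n : ℕ} {F : Type*} [NormedAddCommGroup F] [NormedSpace ℝ F]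
    (s : ℕ) (w : Esp n → F) : ℝ :=
  ∑ k ∈ Finset.range (s + 1), ∫ x, ‖iteratedFDeriv ℝ k w x‖ ^ 2

/-- Sobolev `H^s` norm. -/
def HsNorm {n : ℕ} {F : Type*} [NormedAddCommGroup F] [NormedSpace ℝ F]
    (s : ℕ) (w : Esp n → F) : ℝ :=
  Real.sqrt (HsNormSq s w)

/-- Membership in the Sobolev space `H^s`. -/
def InHs {n : ℕ} {F : Type*} [NormedAddCommGroup F] [NormedSpace ℝ F]
    (s : ℕ) (w : Esp n → F) : Prop :=
  ContDiff ℝ s w ∧ ∀ k ≤ s, Integrable (fun x => ‖iteratedFDeriv ℝ k w x‖ ^ 2)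

/-- Membership in `H^s` for all `s` (i.e. in `H^∞`). -/
def InHinf {n : ℕ} {F : Type*} [NormedAddCommGroup F] [NormedSpace ℝ F]
    (w : Esp n → F) : Prop :=
  ContDiff ℝ (⊤ : ℕ∞) w ∧ ∀ s : ℕ, InHs s w

/-- `t ↦ a t` is continuous with values in `H^s` on `[0,T]`. -/
def ContHs {n : ℕ} {F : Type*} [NormedAddCommGroup F] [NormedSpace ℝ F]
    (T : ℝ) (s : ℕ) (a : ℝ → Esp n → F) : Prop :=
  (∀ t ∈ Icc (0:ℝ) T, InHs s (a t)) ∧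
  ∀ t₀ ∈ Icc (0:ℝ) T, Tendsto (fun t => HsNorm s (fun x => a t x - a t₀ x))
    (nhdsWithin t₀ (Icc (0:ℝ) T)) (nhds 0)

/-- The `L² ∩ L^∞` norm. -/
def L2LinfNorm {n : ℕ} {F : Type*} [NormedAddCommGroup F] [NormedSpace ℝ F]
    (w : Esp n → F) : ℝ :=
  (eLpNorm w 2 volume).toReal + (eLpNorm w ⊤ volume).toReal

/-- Smoothness on the time slab `[0,T] × ℝⁿ`. -/
def SmoothOnSlab {n : ℕ} {F : Type*} [NormedAddCommGroup F] [NormedSpace ℝ F]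
    (T : ℝ) (u : ℝ → Esp n → F) : Prop :=
  ContDiffOn ℝ (⊤ : ℕ∞) (fun p : ℝ × Esp n => u p.1 p.2) (Icc (0:ℝ) T ×ˢ univ)

/-- All spatial derivatives of `φ` of order `≥ 2` are bounded on `[0,T] × ℝⁿ`. -/
def SubquadSlab {n : ℕ} (T : ℝ) (φ : ℝ → Esp n → ℝ) : Prop :=
  ∀ k : ℕ, 2 ≤ k → ∃ C, ∀ t ∈ Icc (0:ℝ) T, ∀ x, ‖iteratedFDeriv ℝ k (φ t) x‖ ≤ C

/-- Geometrical assumption: smooth subquadratic potential and initial phase. -/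
structure GeomAssump (n : ℕ) (V : ℝ → Esp n → ℝ) (φ0 : Esp n → ℝ) : Prop where
  smoothV : ContDiff ℝ (⊤ : ℕ∞) (fun p : ℝ × Esp n => V p.1 p.2)
  subquadV : ∀ k : ℕ, 2 ≤ k → ∀ R > (0:ℝ), ∃ C, ∀ t : ℝ, |t| ≤ R → ∀ x,
    ‖iteratedFDeriv ℝ k (V t) x‖ ≤ C
  smoothφ0 : ContDiff ℝ (⊤ : ℕ∞) φ0
  subquadφ0 : ∀ k : ℕ, 2 ≤ k → ∃ C, ∀ x, ‖iteratedFDeriv ℝ k φ0 x‖ ≤ C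

/-- `φ` is a smooth solution on `[0,T] × ℝⁿ` of the eikonal equation
`∂_t φ + (1/2)|∇φ|² + V = 0`, `φ(0,·) = φ0`. -/
structure IsEikSol {n : ℕ} (V : ℝ → Esp n → ℝ) (φ0 : Esp n → ℝ)
    (T : ℝ) (φ : ℝ → Esp n → ℝ) : Prop where
  smooth : SmoothOnSlab T φ
  eq : ∀ t ∈ Icc (0:ℝ) T, ∀ x,
    deriv (fun s => φ s x) t + (1/2) * gdotR (φ t) (φ t) x + V t x = 0
  init : ∀ x, φ 0 x = φ0 x

/-- The Hamiltonian flow of `H = τ + |ξ|²/2 + V(t,x)` issued from `(y, ∇φ0(y))`. -/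
structure IsHamFlow {n : ℕ} (V : ℝ → Esp n → ℝ) (φ0 : Esp n → ℝ)
    (X Ξ : ℝ → Esp n → Esp n) : Prop where
  init_x : ∀ y, X 0 y = y
  init_xi : ∀ y, Ξ 0 y = gradient φ0 y
  dx : ∀ t y, HasDerivAt (fun s => X s y) (Ξ t y) t
  dxi : ∀ t y, HasDerivAt (fun s => Ξ s y) (-(gradient (V t) (X t y))) t

/-- Analytical assumption: smooth nonlinearity, initial amplitudes converging in every `H^s`. -/
structure AnalAssump (n : ℕ) (f : ℝ → ℝ) (a0e : ℝ → Esp n → ℂ) (a0 : Esp n → ℂ) : Prop where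
  smoothf : ContDiff ℝ (⊤ : ℕ∞) f
  a0_Hinf : InHinf a0
  conv : ∀ s : ℕ, Tendsto (fun ε => HsNorm s (fun x => a0e ε x - a0 x))
    (nhdsWithin 0 (Ioi 0)) (nhds 0)



/-- Family of maps, `C^k` with derivatives of orders `1..k` bounded uniformly. -/
def BD {ι X Y : Type} [NormedAddCommGroup X] [NormedSpace ℝ X]
    [NormedAddCommGroup Y] [NormedSpace ℝ Y] (k : ℕ) (g : ι → X → Y) : Prop :=
  (∀ i, ContDiff ℝ k (g i)) ∧
    ∀ j, 1 ≤ j → j ≤ k → ∃ C, ∀ i x, ‖iteratedFDeriv ℝ j (g i) x‖ ≤ C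

/-- Uniformly bounded family. -/
def UB {ι X Y : Type} [NormedAddCommGroup Y] (g : ι → X → Y) : Prop :=
  ∃ C, ∀ i x, ‖g i x‖ ≤ C

set_option linter.unusedSectionVars false

section bdd
variable {ι X Y Z W R : Type} [NormedAddCommGroup X] [NormedSpace ℝ X]
    [NormedAddCommGroup Y] [NormedSpace ℝ Y] [NormedAddCommGroup Z] [NormedSpace ℝ Z]
    [NormedAddCommGroup W] [NormedSpace ℝ W]

theorem BD_succ_iff {k : ℕ} {g : ι → X → Y} :
    BD (k + 1) g ↔ (∀ i, Differentiable ℝ (g i)) ∧ UB (fun i => fderiv ℝ (g i)) ∧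
      BD k (fun i => fderiv ℝ (g i)) := by
  have hc : ∀ i, ContDiff ℝ ((k + 1 : ℕ) : WithTop ℕ∞) (g i) ↔
      Differentiable ℝ (g i) ∧ ContDiff ℝ k (fderiv ℝ (g i)) := by
    intro i
    rw [Nat.cast_add, Nat.cast_one, contDiff_succ_iff_fderiv]
    simp
  constructor
  · rintro ⟨h1, h2⟩
    refine ⟨fun i => ((hc i).1 (h1 i)).1, ?_, fun i => ((hc i).1 (h1 i)).2, ?_⟩
    · obtain ⟨C, hC⟩ := h2 1 le_rfl (by omega)
      refine ⟨C, fun i x => ?_⟩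
      have := hC i x
      rw [← norm_iteratedFDeriv_fderiv, norm_iteratedFDeriv_zero] at this
      exact this
    · intro j h1j hj
      obtain ⟨C, hC⟩ := h2 (j + 1) (by omega) (by omega)
      refine ⟨C, fun i x => ?_⟩
      rw [norm_iteratedFDeriv_fderiv]
      exact hC i x
  · rintro ⟨h1, ⟨C, hC⟩, h3, h4⟩
    refine ⟨fun i => (hc i).2 ⟨h1 i, h3 i⟩, ?_⟩
    rintro (_ | _ | j) h1j hj
    · omega
    · refine ⟨C, fun i x => ?_⟩
      rw [← norm_iteratedFDeriv_fderiv, norm_iteratedFDeriv_zero]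
      exact hC i x
    · obtain ⟨C, hC⟩ := h4 (j + 1) (by omega) (by omega)
      refine ⟨C, fun i x => ?_⟩
      rw [← norm_iteratedFDeriv_fderiv]
      exact hC i x

theorem BD_zero_iff {g : ι → X → Y} : BD 0 g ↔ ∀ i, Continuous (g i) := by
  constructor
  · intro h i
    exact (h.1 i).continuous
  · intro h
    refine ⟨fun i => ?_, fun j h1 h2 => by omega⟩
    exact contDiff_zero.2 (h i)

theorem BD.mono {k l : ℕ} (hkl : k ≤ l) {g : ι → X → Y} (h : BD l g) : BD k g :=
  ⟨fun i => (h.1 i).of_le (by exact_mod_cast hkl), fun j h1 h2 => h.2 j h1 (h2.trans hkl)⟩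

theorem BD.add {k : ℕ} {f g : ι → X → Y} (hf : BD k f) (hg : BD k g) :
    BD k (fun i x => f i x + g i x) := by
  refine ⟨fun i => (hf.1 i).add (hg.1 i), fun j h1 h2 => ?_⟩
  obtain ⟨C, hC⟩ := hf.2 j h1 h2
  obtain ⟨D, hD⟩ := hg.2 j h1 h2
  refine ⟨C + D, fun i x => ?_⟩
  have hj : (j : WithTop ℕ∞) ≤ k := by exact_mod_cast h2
  have : iteratedFDeriv ℝ j (fun x => f i x + g i x) x
      = iteratedFDeriv ℝ j (f i) x + iteratedFDeriv ℝ j (g i) x :=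
    iteratedFDeriv_add_apply ((hf.1 i).of_le hj).contDiffAt ((hg.1 i).of_le hj).contDiffAt
  rw [this]
  exact (norm_add_le _ _).trans (add_le_add (hC i x) (hD i x))

theorem BD.const (k : ℕ) (c : ι → Y) : BD k (fun i (_ : X) => c i) := by
  refine ⟨fun i => contDiff_const, fun j h1 _ => ⟨0, fun i x => ?_⟩⟩
  have h : iteratedFDeriv ℝ j (fun _ : X => c i) = 0 :=
    iteratedFDeriv_const_of_ne (𝕜 := ℝ) (by omega) _
  rw [h]
  simp

theorem BD.clm (k : ℕ) (L : ι → X →L[ℝ] Y) (hL : ∃ C, ∀ i, ‖L i‖ ≤ C) :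
    BD k (fun i x => L i x) := by
  cases k with
  | zero => exact BD_zero_iff.2 fun i => (L i).continuous
  | succ k =>
    rw [BD_succ_iff]
    have : (fun i => fderiv ℝ (fun x => L i x)) = fun i (_ : X) => L i := by
      funext i x
      exact (L i).fderiv
    rw [this]
    obtain ⟨C, hC⟩ := hL
    exact ⟨fun i => (L i).differentiable, ⟨C, fun i _ => hC i⟩, BD.const _ _⟩

theorem BD.lin (k : ℕ) (f : X → Y) (hf : IsBoundedLinearMap ℝ f) : BD k (fun _ : Unit => f) :=
  BD.clm k (fun _ : Unit => hf.toContinuousLinearMap) ⟨_, fun _ => le_rfl⟩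

theorem UB.bilin (B : X →L[ℝ] Y →L[ℝ] Z) {f : ι → W → X} {g : ι → W → Y}
    (hf : UB f) (hg : UB g) : UB (fun i x => B (f i x) (g i x)) := by
  obtain ⟨C, hC⟩ := hf
  obtain ⟨D, hD⟩ := hg
  refine ⟨‖B‖ * C * D, fun i x => (B.le_opNorm₂ _ _).trans ?_⟩
  have := hC i x
  have := hD i x
  have : 0 ≤ C := (norm_nonneg _).trans (hC i x)
  gcongr

theorem UB.add {f g : ι → X → Y} (hf : UB f) (hg : UB g) : UB (fun i x => f i x + g i x) := by
  obtain ⟨C, hC⟩ := hf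
  obtain ⟨D, hD⟩ := hg
  exact ⟨C + D, fun i x => (norm_add_le _ _).trans (add_le_add (hC i x) (hD i x))⟩

theorem BD.bilin (k : ℕ) : ∀ {X Y Z : Type} [NormedAddCommGroup X] [NormedSpace ℝ X]
    [NormedAddCommGroup Y] [NormedSpace ℝ Y] [NormedAddCommGroup Z] [NormedSpace ℝ Z]
    (B : X →L[ℝ] Y →L[ℝ] Z) {f : ι → W → X} {g : ι → W → Y}
    (_ : UB f) (_ : UB g) (_ : BD k f) (_ : BD k g),
    BD k (fun i x => B (f i x) (g i x)) := by
  induction k with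
  | zero =>
    intro X Y Z _ _ _ _ _ _ B f g _ _ h1 h2
    rw [BD_zero_iff] at *
    intro i
    have := h1 i
    have := h2 i
    fun_prop
  | succ k ih =>
    intro X Y Z _ _ _ _ _ _ B f g uf ug h1 h2
    have h1' := h1.mono (Nat.le_succ k)
    have h2' := h2.mono (Nat.le_succ k)
    rw [BD_succ_iff] at *
    have : (fun i => fderiv ℝ (fun x => B (f i x) (g i x))) = fun i x =>
        B.precompR W (f i x) (fderiv ℝ (g i) x) + B.precompL W (fderiv ℝ (f i) x) (g i x) := by
      funext i x
      exact B.fderiv_of_bilinear (h1.1 i x) (h2.1 i x)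
    rw [this]
    refine ⟨fun i x => ?_, ?_, ?_⟩
    · exact (B.hasFDerivAt_of_bilinear (h1.1 i x).hasFDerivAt
        (h2.1 i x).hasFDerivAt).differentiableAt
    · exact UB.add (UB.bilin _ uf h2.2.1) (UB.bilin _ h1.2.1 ug)
    · exact BD.add (ih _ uf h2.2.1 h1' h2.2.2) (ih _ h1.2.1 ug h1.2.2 h2')

theorem BD.comp (k : ℕ) : ∀ {X Y Z : Type} [NormedAddCommGroup X] [NormedSpace ℝ X]
    [NormedAddCommGroup Y] [NormedSpace ℝ Y] [NormedAddCommGroup Z] [NormedSpace ℝ Z]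
    {g : ι → Y → Z} {f : ι → X → Y} (_ : BD k g) (_ : BD k f),
    BD k (fun i x => g i (f i x)) := by
  induction k with
  | zero =>
    intro X Y Z _ _ _ _ _ _ g f h1 h2
    rw [BD_zero_iff] at *
    exact fun i => (h1 i).comp (h2 i)
  | succ k ih =>
    intro X Y Z _ _ _ _ _ _ g f h1 h2
    have h2' := h2.mono (Nat.le_succ k)
    rw [BD_succ_iff] at *
    have : (fun i => fderiv ℝ (fun x => g i (f i x))) = fun i x =>
        ContinuousLinearMap.compL ℝ X Y Z (fderiv ℝ (g i) (f i x)) (fderiv ℝ (f i) x) := by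
      funext i x
      exact fderiv_comp x (h1.1 i _) (h2.1 i x)
    rw [this]
    have hu : UB (fun i x => fderiv ℝ (g i) (f i x)) := by
      obtain ⟨C, hC⟩ := h1.2.1
      exact ⟨C, fun i x => hC i _⟩
    exact ⟨fun i => (h1.1 i).comp (h2.1 i), UB.bilin _ hu h2.2.1,
      BD.bilin k _ hu h2.2.1 (ih h1.2.2 h2') h2.2.2⟩

theorem BD.inverse [NormedRing R] [NormedAlgebra ℝ R] [CompleteSpace R] (k : ℕ)
    {B : ι → X → R} (hB : BD k B) (hu : ∀ i x, IsUnit (B i x))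
    (hb : UB (fun i x => Ring.inverse (B i x))) :
    BD k (fun i x => Ring.inverse (B i x)) := by
  induction k with
  | zero =>
    rw [BD_zero_iff] at *
    intro i
    rw [continuous_iff_continuousAt]
    intro x
    obtain ⟨u, hu'⟩ := hu i x
    refine ContinuousAt.comp (g := Ring.inverse) (f := B i) ?_ (hB i).continuousAt
    rw [← hu']
    exact NormedRing.inverse_continuousAt u
  | succ k ih =>
    have hB' := ih (hB.mono (Nat.le_succ k))
    rw [BD_succ_iff] at *
    have hd : ∀ i x, HasFDerivAt (fun x => Ring.inverse (B i x))
        (ContinuousLinearMap.compL ℝ X R R ((-ContinuousLinearMap.mulLeftRight ℝ R)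
          (Ring.inverse (B i x)) (Ring.inverse (B i x))) (fderiv ℝ (B i) x)) x := by
      intro i x
      obtain ⟨u, hu'⟩ := hu i x
      have h := hasFDerivAt_ringInverse (𝕜 := ℝ) u
      have e : Ring.inverse (B i x) = (↑u⁻¹ : R) := by rw [← hu', Ring.inverse_unit]
      rw [e]
      rw [hu'] at h
      exact h.comp x (hB.1 i x).hasFDerivAt
    have : (fun i => fderiv ℝ (fun x => Ring.inverse (B i x))) = fun i x =>
        (ContinuousLinearMap.compL ℝ X R R ((-ContinuousLinearMap.mulLeftRight ℝ R)
          (Ring.inverse (B i x)) (Ring.inverse (B i x))) (fderiv ℝ (B i) x)) := by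
      funext i x
      exact (hd i x).fderiv
    rw [this]
    have hub := UB.bilin (-ContinuousLinearMap.mulLeftRight ℝ R) hb hb
    exact ⟨fun i x => (hd i x).differentiableAt, UB.bilin _ hub hB.2.1,
      BD.bilin k _ hub hB.2.1 (BD.bilin k _ hb hb hB' hB') hB.2.2⟩

/-- The inverse of a perturbation of the identity by a contraction. -/
theorem exists_inverse [CompleteSpace X] (P : X → X) (hP : ∀ k, BD k (fun _ : Unit => P))
    (hlip : LipschitzWith (1 / 2) P) :
    ∃ S : X → X, (∀ c, S c = c + P (S c)) ∧ ∀ k, BD k (fun _ : Unit => S) := by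
  have happ : ApproximatesLinearOn (fun x => x - P x)
      ((ContinuousLinearEquiv.refl ℝ X : X ≃L[ℝ] X) : X →L[ℝ] X) univ (1 / 2) := by
    rintro x - y -
    have := hlip.dist_le_mul y x
    rw [dist_eq_norm, dist_eq_norm, norm_sub_rev y x] at this
    have e : x - P x - (y - P y) - (x - y) = P y - P x := by abel
    change ‖x - P x - (y - P y) - (x - y)‖ ≤ _
    rw [e]
    exact this
  have hc : Subsingleton X ∨ (1 / 2 : NNReal) <
      ‖(((ContinuousLinearEquiv.refl ℝ X).symm : X ≃L[ℝ] X) : X →L[ℝ] X)‖₊⁻¹ := by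
    rcases subsingleton_or_nontrivial X with h | h
    · exact Or.inl h
    · right
      simp only [ContinuousLinearEquiv.refl_symm, ContinuousLinearEquiv.coe_refl]
      rw [show ‖ContinuousLinearMap.id ℝ X‖₊ = 1 from
        NNReal.eq (ContinuousLinearMap.norm_id)]
      rw [inv_one]
      exact_mod_cast (by norm_num : (1 / 2 : ℝ) < 1)
  let H := happ.toHomeomorph _ hc
  have hH : ∀ x, H x = x - P x := fun x => rfl
  have hS : ∀ c, H.symm c = c + P (H.symm c) := by
    intro c
    have := H.apply_symm_apply c
    rw [hH] at this
    exact (sub_eq_iff_eq_add.1 this)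
  have hPd : Differentiable ℝ P := (BD_succ_iff.1 (hP 1)).1 ()
  have hPn : ∀ x, ‖fderiv ℝ P x‖ ≤ 1 / 2 := fun x => by
    simpa using norm_fderiv_le_of_lipschitz ℝ hlip (x₀ := x)
  have hlt : ∀ x, ‖fderiv ℝ P x‖ < 1 := fun x => (hPn x).trans_lt (by norm_num)
  have hunit : ∀ x, IsUnit (1 - fderiv ℝ P x) := fun x => isUnit_one_sub_of_norm_lt_one (hlt x)
  have hinv : ∀ x, ‖Ring.inverse (1 - fderiv ℝ P x)‖ ≤ 2 := by
    intro x
    have h1 := Ring.mul_inverse_cancel _ (hunit x)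
    set Y := Ring.inverse (1 - fderiv ℝ P x)
    have h2 : Y = 1 + fderiv ℝ P x * Y := by
      rw [sub_mul, one_mul] at h1
      exact sub_eq_iff_eq_add.1 h1
    have h3 : ‖Y‖ ≤ 1 + 1 / 2 * ‖Y‖ := by
      calc ‖Y‖ = ‖1 + fderiv ℝ P x * Y‖ := by rw [← h2]
        _ ≤ ‖(1 : X →L[ℝ] X)‖ + ‖fderiv ℝ P x‖ * ‖Y‖ :=
          (norm_add_le _ _).trans (by gcongr; exact norm_mul_le _ _)
        _ ≤ 1 + 1 / 2 * ‖Y‖ := by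
          gcongr
          · exact ContinuousLinearMap.norm_id_le
          · exact hPn x
    linarith
  have hder : ∀ c, HasFDerivAt H.symm (Ring.inverse (1 - fderiv ℝ P (H.symm c))) c := by
    intro c
    obtain ⟨u, hu⟩ := hunit (H.symm c)
    rw [← hu, Ring.inverse_unit]
    have := HasFDerivAt.of_local_left_inverse (f := H) (g := H.symm) (a := c)
      (f' := ContinuousLinearEquiv.unitsEquiv ℝ X u) H.symm.continuous.continuousAt ?_
      (Filter.Eventually.of_forall H.apply_symm_apply)
    · exact this
    · have h1 : HasFDerivAt (fun x => x - P x) (1 - fderiv ℝ P (H.symm c)) (H.symm c) :=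
        (hasFDerivAt_id _).sub (hPd _).hasFDerivAt
      rw [← hu] at h1
      exact h1
  refine ⟨H.symm, hS, fun k => ?_⟩
  have hfd : (fun _ : Unit => fderiv ℝ H.symm) = fun _ c =>
      Ring.inverse (1 + (-1 : ℝ) • fderiv ℝ P (H.symm c)) := by
    funext _ c
    rw [(hder c).fderiv]
    congr 1
    rw [neg_smul, one_smul, sub_eq_add_neg]
  induction k with
  | zero => exact BD_zero_iff.2 fun _ => H.symm.continuous
  | succ k ih =>
    rw [BD_succ_iff]
    have hub : UB (fun _ : Unit => fderiv ℝ H.symm) := by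
      refine ⟨2, fun _ c => ?_⟩
      change ‖fderiv ℝ H.symm c‖ ≤ 2
      rw [(hder c).fderiv]
      exact hinv _
    refine ⟨fun _ c => (hder c).differentiableAt, hub, ?_⟩
    rw [hfd] at hub ⊢
    have h1 := BD.comp k (BD_succ_iff.1 (hP (k + 1))).2.2 ih
    have h2 := BD.comp k (BD.clm k (fun _ : Unit => (-1 : ℝ) • ContinuousLinearMap.id ℝ (X →L[ℝ] X))
      ⟨_, fun _ => le_rfl⟩) h1
    refine BD.inverse k ?_ ?_ hub
    · exact (BD.const k (fun _ => 1)).add h2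
    · intro _ c
      rw [neg_smul, one_smul, ← sub_eq_add_neg]
      exact hunit _

end bdd

section nemytskii
variable {T : ℝ} {G H : Type} [NormedAddCommGroup G] [NormedSpace ℝ G]
    [NormedAddCommGroup H] [NormedSpace ℝ H]

/-- Superposition operator. -/
def Nem (T : ℝ) (f : ℝ → G → H) (hf : Continuous (Function.uncurry f))
    (u : C(Icc (-T) T, G)) : C(Icc (-T) T, H) :=
  ⟨fun t => f t (u t), hf.comp (by fun_prop : Continuous fun t : Icc (-T) T => ((t : ℝ), u t))⟩

/-- Pointwise application of operators. -/
def Mop (T : ℝ) (G H : Type) [NormedAddCommGroup G] [NormedSpace ℝ G]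
    [NormedAddCommGroup H] [NormedSpace ℝ H] :
    C(Icc (-T) T, G →L[ℝ] H) →L[ℝ] C(Icc (-T) T, G) →L[ℝ] C(Icc (-T) T, H) :=
  LinearMap.mkContinuous₂
    (LinearMap.mk₂ ℝ (fun (A : C(Icc (-T) T, G →L[ℝ] H)) (u : C(Icc (-T) T, G)) =>
      (⟨fun t => A t (u t), by fun_prop⟩ : C(Icc (-T) T, H)))
      (by intros; ext; simp) (by intros; ext; simp) (by intros; ext; simp) (by intros; ext; simp))
    1 (by
      intro A u
      rw [ContinuousMap.norm_le _ (by positivity)]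
      intro t
      rw [one_mul]
      exact ((A t).le_opNorm _).trans (by gcongr <;> exact ContinuousMap.norm_coe_le_norm _ t))

theorem Mop_apply (A : C(Icc (-T) T, G →L[ℝ] H)) (u : C(Icc (-T) T, G)) (t : Icc (-T) T) :
    Mop T G H A u t = A t (u t) := rfl

theorem Mop_norm_le (A : C(Icc (-T) T, G →L[ℝ] H)) : ‖Mop T G H A‖ ≤ ‖A‖ := by
  refine ContinuousLinearMap.opNorm_le_bound _ (norm_nonneg A) fun u => ?_
  rw [ContinuousMap.norm_le _ (by positivity)]
  intro t
  exact ((A t).le_opNorm _).trans (by gcongr <;> exact ContinuousMap.norm_coe_le_norm _ t)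

theorem Mop_bdd : IsBoundedLinearMap ℝ (fun A => Mop T G H A) :=
  IsLinearMap.with_bound ⟨fun x y => map_add _ x y, fun c x => map_smul _ c x⟩ 1
    fun A => by rw [one_mul]; exact Mop_norm_le A

theorem quad_bound {f : G → H} {C : ℝ} (hf : Differentiable ℝ f)
    (hf' : Differentiable ℝ (fderiv ℝ f)) (hC : ∀ x, ‖fderiv ℝ (fderiv ℝ f) x‖ ≤ C) (x h : G) :
    ‖f (x + h) - f x - fderiv ℝ f x h‖ ≤ C * ‖h‖ * ‖h‖ := by
  have h0 : 0 ≤ C := le_trans (norm_nonneg (fderiv ℝ (fderiv ℝ f) x)) (hC x)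
  have key := (convex_closedBall x ‖h‖).norm_image_sub_le_of_norm_fderiv_le' (𝕜 := ℝ) (f := f)
    (φ := fderiv ℝ f x) (C := C * ‖h‖) (x := x) (y := x + h) (fun z _ => hf z) ?_ (by simp)
    (by simp)
  · simpa using key
  · intro z hz
    have := convex_univ.norm_image_sub_le_of_norm_fderiv_le (𝕜 := ℝ) (f := fderiv ℝ f) (C := C)
      (x := x) (y := z) (fun z _ => hf' z) (fun z _ => hC z) (mem_univ _) (mem_univ _)
    refine this.trans ?_
    gcongr
    simpa [dist_eq_norm] using hz

theorem smooth_fderiv {f : ℝ → G → H} (hf : ContDiff ℝ (⊤ : ℕ∞) (Function.uncurry f)) :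
    ContDiff ℝ (⊤ : ℕ∞) (Function.uncurry fun t x => fderiv ℝ (f t) x) := by
  have h1 : ContDiff ℝ (⊤ : ℕ∞)
      (Function.uncurry fun (p : ℝ × G) (x : G) => f p.1 x) :=
    hf.comp (by fun_prop : ContDiff ℝ (⊤ : ℕ∞) fun q : (ℝ × G) × G => (q.1.1, q.2))
  exact ContDiff.fderiv (m := (⊤ : ℕ∞)) h1 contDiff_snd le_rfl

theorem Nem_hasFDerivAt {f : ℝ → G → H} (hf : ContDiff ℝ (⊤ : ℕ∞) (Function.uncurry f))
    (hb : ∀ k, BD k (fun t : Icc (-T) T => f t)) (u : C(Icc (-T) T, G)) :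
    HasFDerivAt (Nem T f hf.continuous)
      (Mop T G H (Nem T (fun t x => fderiv ℝ (f t) x) (smooth_fderiv hf).continuous u)) u := by
  have h1 := BD_succ_iff.1 (hb 2)
  have h2 := BD_succ_iff.1 h1.2.2
  obtain ⟨C, hC⟩ := h2.2.1
  rw [hasFDerivAt_iff_isLittleO_nhds_zero]
  refine Asymptotics.IsBigO.trans_isLittleO (g := fun h : C(Icc (-T) T, G) => ‖h‖ ^ 2) ?_
    (Asymptotics.isLittleO_norm_pow_id one_lt_two)
  refine Asymptotics.IsBigO.of_bound (max C 0) (Filter.Eventually.of_forall fun h => ?_)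
  rw [ContinuousMap.norm_le _ (by positivity)]
  intro t
  have := quad_bound (h1.1 t) (h2.1 t) (C := max C 0)
    (fun x => (hC t x).trans (le_max_left _ _)) (u t) (h t)
  refine le_trans this ?_
  have ht := ContinuousMap.norm_coe_le_norm h t
  rw [norm_pow, norm_norm, pow_two, mul_assoc]
  gcongr

theorem Nem_BD (k : ℕ) : ∀ {H : Type} [NormedAddCommGroup H] [NormedSpace ℝ H]
    {f : ℝ → G → H} (hf : ContDiff ℝ (⊤ : ℕ∞) (Function.uncurry f))
    (_ : ∀ k, BD k (fun t : Icc (-T) T => f t)),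
    BD k (fun _ : Unit => Nem T f hf.continuous) := by
  induction k with
  | zero =>
    intro H _ _ f hf hb
    exact BD_zero_iff.2 fun _ => (Differentiable.continuous (𝕜 := ℝ)
      fun u => (Nem_hasFDerivAt hf hb u).differentiableAt)
  | succ k ih =>
    intro H _ _ f hf hb
    rw [BD_succ_iff]
    have e : (fun _ : Unit => fderiv ℝ (Nem T f hf.continuous)) = fun _ u =>
        Mop T G H (Nem T (fun t x => fderiv ℝ (f t) x) (smooth_fderiv hf).continuous u) := by
      funext _ u
      exact (Nem_hasFDerivAt hf hb u).fderiv
    rw [e]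
    refine ⟨fun _ u => (Nem_hasFDerivAt hf hb u).differentiableAt, ?_, ?_⟩
    · obtain ⟨C, hC⟩ := (BD_succ_iff.1 (hb 1)).2.1
      refine ⟨max C 0, fun _ u => (Mop_norm_le _).trans ?_⟩
      rw [ContinuousMap.norm_le _ (by positivity)]
      exact fun t => (hC t _).trans (le_max_left _ _)
    · exact BD.comp k (BD.lin k _ Mop_bdd)
        (ih (smooth_fderiv hf) fun k => (BD_succ_iff.1 (hb (k + 1))).2.2)

end nemytskii

section slab
variable {T : ℝ} {G Y : Type} [NormedAddCommGroup G] [NormedSpace ℝ G]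
    [NormedAddCommGroup Y] [NormedSpace ℝ Y]

/-- Extension of a function on the slab to the line. -/
def extI (hT : 0 < T) (u : C(Icc (-T) T, G)) (s : ℝ) : G :=
  u (projIcc (-T) T (by linarith) s)

theorem extI_cont (hT : 0 < T) (u : C(Icc (-T) T, G)) : Continuous (extI hT u) :=
  u.continuous.comp continuous_projIcc

theorem extI_coe (hT : 0 < T) (u : C(Icc (-T) T, G)) (t : Icc (-T) T) : extI hT u t = u t := by
  unfold extI
  rw [projIcc_val]

/-- Integration from zero. -/
def Jop (hT : 0 < T) (G : Type) [NormedAddCommGroup G] [NormedSpace ℝ G] :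
    C(Icc (-T) T, G) →L[ℝ] C(Icc (-T) T, G) :=
  LinearMap.mkContinuous
    { toFun := fun u => ⟨fun t => ∫ s in (0 : ℝ)..t, extI hT u s,
        (intervalIntegral.continuous_primitive
          (fun a b => (extI_cont hT u).intervalIntegrable a b) 0).comp continuous_subtype_val⟩
      map_add' := by
        intro u v
        ext t
        exact intervalIntegral.integral_add ((extI_cont hT u).intervalIntegrable _ _)
          ((extI_cont hT v).intervalIntegrable _ _)
      map_smul' := by
        intro c u
        ext t
        exact intervalIntegral.integral_smul _ _ }
    T (by
      intro u
      rw [ContinuousMap.norm_le _ (by positivity)]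
      intro t
      refine (intervalIntegral.norm_integral_le_of_norm_le_const (C := ‖u‖)
        (fun s _ => ContinuousMap.norm_coe_le_norm _ _)).trans ?_
      rw [mul_comm]
      gcongr
      rw [sub_zero]
      exact abs_le.2 t.2)

theorem Jop_apply (hT : 0 < T) (u : C(Icc (-T) T, G)) (t : Icc (-T) T) :
    Jop hT G u t = ∫ s in (0 : ℝ)..t, extI hT u s := rfl

theorem exp_int {l : ℝ} (hl : 0 < l) (t : ℝ) :
    |∫ s in (0 : ℝ)..t, Real.exp (l * |s|)| ≤ Real.exp (l * |t|) / l := by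
  have pos : ∀ t : ℝ, 0 ≤ t →
      |∫ s in (0 : ℝ)..t, Real.exp (l * |s|)| ≤ Real.exp (l * |t|) / l := by
    intro t ht
    have e : ∫ s in (0 : ℝ)..t, Real.exp (l * |s|) = ∫ s in (0 : ℝ)..t, Real.exp (l * s) := by
      refine intervalIntegral.integral_congr fun s hs => ?_
      rw [uIcc_of_le ht] at hs
      simp only [abs_of_nonneg hs.1]
    rw [e, intervalIntegral.integral_comp_mul_left _ hl.ne', integral_exp, abs_of_nonneg ht]
    have : 1 ≤ Real.exp (l * t) := Real.one_le_exp (by positivity)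
    simp only [mul_zero, Real.exp_zero, smul_eq_mul]
    rw [abs_of_nonneg (by have : 0 < l⁻¹ := inv_pos.2 hl
                          exact mul_nonneg this.le (by linarith)), div_eq_inv_mul]
    gcongr
    linarith
  rcases le_total 0 t with ht | ht
  · exact pos t ht
  · have h := pos (-t) (by linarith)
    have e := intervalIntegral.integral_comp_neg (a := 0) (b := t)
      (fun s => Real.exp (l * |s|))
    simp only [abs_neg, neg_zero] at e
    rw [e, intervalIntegral.integral_symm, abs_neg]
    rwa [abs_neg t] at h

/-- Weight operator. -/
def Wop (T l : ℝ) (G : Type) [NormedAddCommGroup G] [NormedSpace ℝ G] :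
    C(Icc (-T) T, G) →L[ℝ] C(Icc (-T) T, G) :=
  Mop T G G ⟨fun t => Real.exp (l * |(t : ℝ)|) • ContinuousLinearMap.id ℝ G, by fun_prop⟩

theorem Wop_apply (l : ℝ) (u : C(Icc (-T) T, G)) (t : Icc (-T) T) :
    Wop T l G u t = Real.exp (l * |(t : ℝ)|) • u t := rfl

theorem slab_flow [CompleteSpace G] (hT : 0 < T) {F : ℝ → G → G}
    (hF : ContDiff ℝ (⊤ : ℕ∞) (Function.uncurry F))
    (hB : ∀ k, BD k (fun t : Icc (-T) T => F t)) {z0 : Y → G}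
    (hz0 : ∀ k, BD k (fun _ : Unit => z0)) :
    ∃ Z : ℝ → Y → G, (∀ y, Z 0 y = z0 y) ∧
      (∀ y, ∀ t ∈ Ioo (-T) T, HasDerivAt (fun s => Z s y) (F t (Z t y)) t) ∧
      ∀ k, BD k (fun t : Icc (-T) T => Z t) := by
  obtain ⟨K, hK0, hK⟩ : ∃ K, 0 < K ∧ ∀ (t : Icc (-T) T) x y, ‖F t x - F t y‖ ≤ K * ‖x - y‖ := by
    obtain ⟨C, hC⟩ := (BD_succ_iff.1 (hB 1)).2.1
    refine ⟨max C 1, by positivity, fun t x y => ?_⟩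
    exact convex_univ.norm_image_sub_le_of_norm_fderiv_le (𝕜 := ℝ)
      (fun z _ => (BD_succ_iff.1 (hB 1)).1 t z) (fun z _ => (hC t z).trans (le_max_left _ _))
      (mem_univ _) (mem_univ _)
  set l := 2 * K with hl
  have hl0 : 0 < l := by positivity
  let P : C(Icc (-T) T, G) → C(Icc (-T) T, G) := fun u =>
    Wop T (-l) G (Jop hT G (Nem T F hF.continuous (Wop T l G u)))
  have bclm : ∀ (k : ℕ) (L : C(Icc (-T) T, G) →L[ℝ] C(Icc (-T) T, G)),
      BD k (fun _ : Unit => L) := fun k L => BD.clm k (fun _ : Unit => L) ⟨_, fun _ => le_rfl⟩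
  have hP : ∀ k, BD k (fun _ : Unit => P) := fun k =>
    BD.comp k (bclm k _) (BD.comp k (bclm k _) (BD.comp k (Nem_BD k hF hB) (bclm k _)))
  have hlip : LipschitzWith (1 / 2) P := by
    refine LipschitzWith.of_dist_le_mul fun u v => ?_
    rw [dist_eq_norm, dist_eq_norm, ContinuousMap.norm_le _ (by positivity)]
    intro t
    have e : (P u - P v) t = Real.exp (-l * |(t : ℝ)|) • ∫ s in (0 : ℝ)..t,
        (extI hT (Nem T F hF.continuous (Wop T l G u)) s
          - extI hT (Nem T F hF.continuous (Wop T l G v)) s) := by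
      rw [intervalIntegral.integral_sub ((extI_cont hT _).intervalIntegrable _ _)
          ((extI_cont hT _).intervalIntegrable _ _), smul_sub]
      rfl
    rw [e, norm_smul, Real.norm_of_nonneg (Real.exp_pos _).le]
    have b : ‖∫ s in (0 : ℝ)..t,
        (extI hT (Nem T F hF.continuous (Wop T l G u)) s
          - extI hT (Nem T F hF.continuous (Wop T l G v)) s)‖ ≤
        |∫ s in (0 : ℝ)..t, Real.exp (l * |s|) * (K * ‖u - v‖)| := by
      refine intervalIntegral.norm_integral_le_abs_of_norm_le ?_
        (Continuous.intervalIntegrable (by fun_prop) _ _)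
      refine (ae_restrict_mem measurableSet_uIoc).mono fun s hs => ?_
      have hsI : s ∈ Icc (-T) T := by
        have h0 : (0 : ℝ) ∈ Icc (-T) T := ⟨by linarith, hT.le⟩
        exact (ordConnected_Icc.uIcc_subset h0 t.2) (uIoc_subset_uIcc hs)
      have := extI_coe hT (Nem T F hF.continuous (Wop T l G u)) ⟨s, hsI⟩
      have h2 := extI_coe hT (Nem T F hF.continuous (Wop T l G v)) ⟨s, hsI⟩
      simp only at this h2
      rw [this, h2]
      refine (hK ⟨s, hsI⟩ _ _).trans ?_
      rw [Wop_apply, Wop_apply, ← smul_sub, norm_smul, Real.norm_of_nonneg (Real.exp_pos _).le,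
        mul_left_comm]
      gcongr
      exact ContinuousMap.norm_coe_le_norm (u - v) _
    rw [intervalIntegral.integral_mul_const, abs_mul,
      abs_of_nonneg (by positivity : 0 ≤ K * ‖u - v‖)] at b
    calc _ ≤ Real.exp (-l * |(t : ℝ)|) *
          (Real.exp (l * |(t : ℝ)|) / l * (K * ‖u - v‖)) := by
          gcongr
          refine b.trans ?_
          gcongr
          exact exp_int hl0 t
      _ = (Real.exp (-l * |(t : ℝ)|) * Real.exp (l * |(t : ℝ)|)) * (K / l) * ‖u - v‖ := by ring
      _ = (K / l) * ‖u - v‖ := by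
          rw [← Real.exp_add, neg_mul, neg_add_cancel, Real.exp_zero, one_mul]
      _ = _ := by
          rw [hl]
          congr 1
          rw [NNReal.coe_div]
          push_cast
          field_simp
  obtain ⟨S, hS, hSB⟩ := exists_inverse P hP hlip
  let cst : G →L[ℝ] C(Icc (-T) T, G) :=
    LinearMap.mkContinuous
      { toFun := fun x => ContinuousMap.const _ x
        map_add' := by intros; rfl
        map_smul' := by intros; rfl } 1 (by
        intro x
        rw [ContinuousMap.norm_le _ (by positivity)]
        intro t
        rw [one_mul]
        exact le_rfl)
  let Q : Y → C(Icc (-T) T, G) := fun y => Wop T l G (S (Wop T (-l) G (cst (z0 y))))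
  have hW : ∀ u, Wop T l G (Wop T (-l) G u) = u := by
    intro u
    ext t
    rw [Wop_apply, Wop_apply, smul_smul, ← Real.exp_add, neg_mul, add_neg_cancel, Real.exp_zero,
      one_smul]
  have hQ : ∀ y, Q y = cst (z0 y) + Jop hT G (Nem T F hF.continuous (Q y)) := by
    intro y
    change Wop T l G (S (Wop T (-l) G (cst (z0 y)))) = _
    rw [hS, map_add, hW]
    congr 1
    exact hW _
  have hQB : ∀ k, BD k (fun _ : Unit => Q) := fun k =>
    BD.comp k (bclm k _) (BD.comp k (hSB k) (BD.comp k (bclm k _) (BD.comp k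
      (BD.clm k (fun _ : Unit => cst) ⟨_, fun _ => le_rfl⟩) (hz0 k))))
  have hQe : ∀ y, ∀ t ∈ Icc (-T) T, extI hT (Q y) t
      = z0 y + ∫ s in (0 : ℝ)..t, F (projIcc (-T) T (by linarith) s) (extI hT (Q y) s) := by
    intro y t ht
    have h := extI_coe hT (Q y) ⟨t, ht⟩
    simp only at h
    rw [h]
    exact congrArg (fun q : C(Icc (-T) T, G) => q ⟨t, ht⟩) (hQ y)
  refine ⟨fun t y => extI hT (Q y) t, fun y => ?_, fun y t ht => ?_, fun k => ?_⟩
  · have := hQe y 0 ⟨by linarith, hT.le⟩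
    simpa using this
  · have hcont : Continuous fun s : ℝ =>
        F (projIcc (-T) T (by linarith) s) (extI hT (Q y) s) := by
      have h1 : Continuous fun s : ℝ => ((projIcc (-T) T (by linarith) s : ℝ), extI hT (Q y) s) :=
        (continuous_subtype_val.comp continuous_projIcc).prodMk (extI_cont hT _)
      exact hF.continuous.comp h1
    have hd := (hcont.integral_hasStrictDerivAt 0 t).hasDerivAt.const_add (z0 y)
    rw [projIcc_of_mem _ (Ioo_subset_Icc_self ht)] at hd
    refine hd.congr_of_eventuallyEq ?_
    filter_upwards [Ioo_mem_nhds ht.1 ht.2] with s hs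
    exact hQe y s (Ioo_subset_Icc_self hs)
  · have h1 : BD k (fun _ : Icc (-T) T => Q) :=
      ⟨fun _ => (hQB k).1 (), fun j h1 h2 => by
        obtain ⟨C, hC⟩ := (hQB k).2 j h1 h2
        exact ⟨C, fun _ x => hC () x⟩⟩
    have h2 : BD k (fun (t : Icc (-T) T) (u : C(Icc (-T) T, G)) => ContinuousMap.evalCLM ℝ t u) := by
      refine BD.clm k _ ⟨1, fun t => ?_⟩
      refine ContinuousLinearMap.opNorm_le_bound _ zero_le_one fun u => ?_
      rw [one_mul]
      exact ContinuousMap.norm_coe_le_norm u t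
    have h3 := BD.comp k h2 h1
    convert h3 using 3 with t y
    exact extI_coe hT _ _

end slab

section final

theorem BD.reidx {ι κ X Y : Type} [NormedAddCommGroup X] [NormedSpace ℝ X]
    [NormedAddCommGroup Y] [NormedSpace ℝ Y] {k : ℕ} {g : ι → X → Y} (h : BD k g) (e : κ → ι) :
    BD k (fun i => g (e i)) :=
  ⟨fun i => h.1 (e i), fun j h1 h2 => by
    obtain ⟨C, hC⟩ := h.2 j h1 h2
    exact ⟨C, fun i x => hC (e i) x⟩⟩

theorem global_flow {G Y : Type} [NormedAddCommGroup G] [NormedSpace ℝ G]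
    [NormedAddCommGroup Y] [NormedSpace ℝ Y] [CompleteSpace G] {F : ℝ → G → G}
    (hF : ContDiff ℝ (⊤ : ℕ∞) (Function.uncurry F))
    (hB : ∀ T > (0 : ℝ), ∀ k, BD k (fun t : Icc (-T) T => F t)) {z0 : Y → G}
    (hz0 : ∀ k, BD k (fun _ : Unit => z0)) :
    ∃ Z : ℝ → Y → G, (∀ y, Z 0 y = z0 y) ∧
      (∀ y t, HasDerivAt (fun s => Z s y) (F t (Z t y)) t) ∧
      ∀ T > (0 : ℝ), ∀ k, BD k (fun t : Icc (0 : ℝ) T => Z t) := by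
  have hpos : ∀ m : ℕ, (0 : ℝ) < m + 1 := fun m => by positivity
  choose Zs hs0 hsd hsB using fun m : ℕ => slab_flow (hpos m) hF (hB _ (hpos m)) hz0
  have mono : ∀ m m' : ℕ, m ≤ m' → ∀ y, ∀ t ∈ Ioo (-((m : ℝ) + 1)) (m + 1),
      Zs m t y = Zs m' t y := by
    intro m m' hm y
    have hm' : (m : ℝ) ≤ m' := by exact_mod_cast hm
    obtain ⟨C, hC⟩ := (BD_succ_iff.1 (hB _ (hpos m) 1)).2.1
    have hv : ∀ t ∈ Ioo (-((m : ℝ) + 1)) (m + 1), LipschitzOnWith C.toNNReal (F t) univ := by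
      intro t ht
      refine lipschitzOnWith_univ.2 (lipschitzWith_of_nnnorm_fderiv_le (𝕜 := ℝ)
        ((BD_succ_iff.1 (hB _ (hpos m) 1)).1 ⟨t, Ioo_subset_Icc_self ht⟩) fun x => ?_)
      exact NNReal.coe_le_coe.1
        ((hC ⟨t, Ioo_subset_Icc_self ht⟩ x).trans (Real.le_coe_toNNReal C))
    exact ODE_solution_unique_of_mem_Ioo (s := fun _ => univ) (t₀ := 0) hv
      ⟨by linarith [hpos m], hpos m⟩ (fun t ht => ⟨hsd m y t ht, mem_univ _⟩)
      (fun t ht => ⟨hsd m' y t ⟨by linarith [ht.1], by linarith [ht.2]⟩, mem_univ _⟩)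
      ((hs0 m y).trans (hs0 m' y).symm)
  let Z : ℝ → Y → G := fun t y => Zs ⌈|t|⌉₊ t y
  have hZ : ∀ m : ℕ, ∀ y, ∀ t ∈ Ioo (-((m : ℝ) + 1)) (m + 1), Z t y = Zs m t y := by
    intro m y t ht
    have ht' : t ∈ Ioo (-((⌈|t|⌉₊ : ℝ) + 1)) (⌈|t|⌉₊ + 1) := by
      have h1 := Nat.le_ceil |t|
      exact abs_lt.1 (by linarith)
    rcases le_total ⌈|t|⌉₊ m with h | h
    · exact mono _ _ h y t ht'
    · exact (mono _ _ h y t ht).symm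
  refine ⟨Z, fun y => ?_, fun y t => ?_, fun T hT k => ?_⟩
  · rw [hZ 0 y 0 (by simp)]
    exact hs0 0 y
  · have ht' : t ∈ Ioo (-((⌈|t|⌉₊ : ℝ) + 1)) (⌈|t|⌉₊ + 1) := by
      have h1 := Nat.le_ceil |t|
      exact abs_lt.1 (by linarith)
    rw [hZ _ y t ht']
    refine (hsd _ y t ht').congr_of_eventuallyEq ?_
    filter_upwards [Ioo_mem_nhds ht'.1 ht'.2] with s hs
    exact hZ _ y s hs
  · have hm := Nat.le_ceil T
    have hsub : ∀ t ∈ Icc (0 : ℝ) T, t ∈ Ioo (-((⌈T⌉₊ : ℝ) + 1)) (⌈T⌉₊ + 1) := fun t ht =>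
      ⟨by linarith [ht.1], by linarith [ht.2]⟩
    have h := (hsB ⌈T⌉₊ k).reidx (κ := Icc (0 : ℝ) T)
      (fun t => ⟨t, Ioo_subset_Icc_self (hsub t t.2)⟩)
    have e : (fun t : Icc (0 : ℝ) T => Z t) = fun t : Icc (0 : ℝ) T => Zs ⌈T⌉₊ t := by
      funext t y
      exact hZ _ y _ (hsub t t.2)
    rw [e]
    exact h

theorem toDual_symm_bdd (n : ℕ) :
    IsBoundedLinearMap ℝ (fun l : Esp n →L[ℝ] ℝ => (InnerProductSpace.toDual ℝ (Esp n)).symm l) :=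
  IsLinearMap.with_bound ⟨fun x y => map_add _ x y, fun c x => by simp⟩ 1
    fun l => by rw [one_mul, LinearIsometryEquiv.norm_map]

end final

/-- Under the geometrical assumption, the Hamiltonian flow is globally defined, and for
every `T > 0` and every order `k ≥ 1` its derivatives in `y` of order `k` are bounded
uniformly for `t ∈ [0,T]`. -/
theorem stmt3 {n : ℕ} (V : ℝ → Esp n → ℝ) (φ0 : Esp n → ℝ)
    (hgeom : GeomAssump n V φ0) :
    ∃ X Ξ : ℝ → Esp n → Esp n, IsHamFlow V φ0 X Ξ ∧
      ∀ T > (0:ℝ), ∀ k : ℕ, 1 ≤ k → ∃ C, ∀ t ∈ Icc (0:ℝ) T, ∀ y,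
        ‖iteratedFDeriv ℝ k (X t) y‖ + ‖iteratedFDeriv ℝ k (Ξ t) y‖ ≤ C := by
  set D : (Esp n →L[ℝ] ℝ) →L[ℝ] Esp n := (toDual_symm_bdd n).toContinuousLinearMap with hD
  let A : (Esp n × Esp n) →L[ℝ] (Esp n × Esp n) :=
    (ContinuousLinearMap.inl ℝ (Esp n) (Esp n)).comp (ContinuousLinearMap.snd ℝ (Esp n) (Esp n))
  let B : (Esp n →L[ℝ] ℝ) →L[ℝ] (Esp n × Esp n) :=
    (ContinuousLinearMap.inr ℝ (Esp n) (Esp n)).comp (-D)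
  let F : ℝ → Esp n × Esp n → Esp n × Esp n := fun t z => A z + B (fderiv ℝ (V t) z.1)
  let z0 : Esp n → Esp n × Esp n := fun y =>
    ContinuousLinearMap.inl ℝ (Esp n) (Esp n) y
      + (ContinuousLinearMap.inr ℝ (Esp n) (Esp n)).comp D (fderiv ℝ φ0 y)
  have hV : ContDiff ℝ (⊤ : ℕ∞) (Function.uncurry V) := hgeom.smoothV
  have hF : ContDiff ℝ (⊤ : ℕ∞) (Function.uncurry F) := by
    have h1 := (smooth_fderiv hV).comp
      (by fun_prop : ContDiff ℝ (⊤ : ℕ∞) fun q : ℝ × (Esp n × Esp n) => (q.1, q.2.1))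
    exact (A.contDiff.comp contDiff_snd).add (B.contDiff.comp h1)
  have hVt : ∀ t, ContDiff ℝ (⊤ : ℕ∞) (V t) := fun t =>
    hV.comp (by fun_prop : ContDiff ℝ (⊤ : ℕ∞) fun x : Esp n => (t, x))
  have hB : ∀ T > (0 : ℝ), ∀ k, BD k (fun t : Icc (-T) T => F t) := by
    intro T hT k
    have h1 : BD k (fun t : Icc (-T) T => fderiv ℝ (V t)) := by
      refine ⟨fun t => (hVt t).fderiv_right (by exact_mod_cast le_top), fun j h1 h2 => ?_⟩
      obtain ⟨C, hC⟩ := hgeom.subquadV (j + 1) (by omega) T hT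
      refine ⟨C, fun t x => ?_⟩
      rw [norm_iteratedFDeriv_fderiv]
      exact hC t (abs_le.2 t.2) x
    exact (BD.clm k (fun _ => A) ⟨_, fun _ => le_rfl⟩).add
      (BD.comp k (BD.clm k (fun _ => B) ⟨_, fun _ => le_rfl⟩)
        (BD.comp k h1 (BD.clm k (fun _ => ContinuousLinearMap.fst ℝ (Esp n) (Esp n))
          ⟨_, fun _ => le_rfl⟩)))
  have hz0 : ∀ k, BD k (fun _ : Unit => z0) := by
    intro k
    have h1 : BD k (fun _ : Unit => fderiv ℝ φ0) := by
      refine ⟨fun t => hgeom.smoothφ0.fderiv_right (by exact_mod_cast le_top), fun j h1 h2 => ?_⟩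
      obtain ⟨C, hC⟩ := hgeom.subquadφ0 (j + 1) (by omega)
      refine ⟨C, fun t x => ?_⟩
      rw [norm_iteratedFDeriv_fderiv]
      exact hC x
    exact (BD.clm k (fun _ => ContinuousLinearMap.inl ℝ (Esp n) (Esp n)) ⟨_, fun _ => le_rfl⟩).add
      (BD.comp k (BD.clm k
        (fun _ => (ContinuousLinearMap.inr ℝ (Esp n) (Esp n)).comp D) ⟨_, fun _ => le_rfl⟩) h1)
  obtain ⟨Z, hZ0, hZd, hZB⟩ := global_flow hF hB hz0
  have hF1 : ∀ t z, (F t z).1 = z.2 := fun t z => by simp [F, A, B]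
  have hF2 : ∀ t z, (F t z).2 = -(gradient (V t) z.1) := fun t z => by
    simp only [F, A, B, Prod.snd_add, ContinuousLinearMap.comp_apply,
      ContinuousLinearMap.inl_apply, ContinuousLinearMap.inr_apply, zero_add]
    rfl
  refine ⟨fun t y => (Z t y).1, fun t y => (Z t y).2, ⟨?_, ?_, ?_, ?_⟩, ?_⟩
  · intro y
    simp [hZ0, z0]
  · intro y
    simp only [hZ0, z0, Prod.snd_add, ContinuousLinearMap.comp_apply,
      ContinuousLinearMap.inl_apply, ContinuousLinearMap.inr_apply, zero_add]
    rfl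
  · intro t y
    have := (hasFDerivAt_fst (𝕜 := ℝ) (p := Z t y)).comp_hasDerivAt t (hZd y t)
    rw [← hF1 t (Z t y)]
    exact this
  · intro t y
    have := (hasFDerivAt_snd (𝕜 := ℝ) (p := Z t y)).comp_hasDerivAt t (hZd y t)
    rw [← hF2 t (Z t y)]
    exact this
  · intro T hT k hk
    have h1 := BD.comp k (BD.clm k (fun _ => ContinuousLinearMap.fst ℝ (Esp n) (Esp n))
      ⟨_, fun _ => le_rfl⟩) (hZB T hT k)
    have h2 := BD.comp k (BD.clm k (fun _ => ContinuousLinearMap.snd ℝ (Esp n) (Esp n))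
      ⟨_, fun _ => le_rfl⟩) (hZB T hT k)
    obtain ⟨C1, hC1⟩ := h1.2 k hk le_rfl
    obtain ⟨C2, hC2⟩ := h2.2 k hk le_rfl
    exact ⟨C1 + C2, fun t ht y => add_le_add (hC1 ⟨t, ht⟩ y) (hC2 ⟨t, ht⟩ y)⟩

end
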